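/- Let {λ_k} ⊂ 𝔻 with ∑(1 − |λ_k|²) < ∞, and in a separable Hilbert space H with orthonormal basis {e_k} define the bounded diagonal operator T e_k = λ_k e_k and h = ∑ √(1 − |λ_k|²) e_k. If {λ_k} satisfies the Carleson condition, then {T^n h}_{n=0}^∞ is a frame for H. -/

import Mathlib

open Filter Finset Topology
open scoped ComplexInnerProductSpace

/-- telescoping estimate -/
lemma tele (F : Finset ℕ) (r t : ℕ → ℝ) (ht : ∀ k, 0 ≤ t k) :
    ∑ j ∈ F, t j * Real.exp (-∑ k ∈ F with r j ≤ r k, t k) ≤ 1 - Real.exp (-∑ k ∈ F, t k) := by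
  induction F using Finset.induction_on_min_value r with
  | empty => simp
  | insert a s ha hmin ih =>
    rw [Finset.sum_insert ha]
    have h1 : (Finset.filter (fun k => r a ≤ r k) (insert a s)) = insert a s := by
      apply Finset.filter_true_of_mem
      intro x hx
      rcases Finset.mem_insert.1 hx with rfl | hx
      · exact le_rfl
      · exact hmin x hx
    have h2 : ∑ j ∈ s, t j * Real.exp (-∑ k ∈ insert a s with r j ≤ r k, t k) ≤
        ∑ j ∈ s, t j * Real.exp (-∑ k ∈ s with r j ≤ r k, t k) := by
      apply Finset.sum_le_sum
      intro j hj
      apply mul_le_mul_of_nonneg_left _ (ht j)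
      apply Real.exp_le_exp.2
      apply neg_le_neg
      apply Finset.sum_le_sum_of_subset_of_nonneg
      · exact Finset.filter_subset_filter _ (Finset.subset_insert _ _)
      · intro i _ _; exact ht i
    rw [h1, Finset.sum_insert ha]
    set S := ∑ k ∈ s, t k
    have h3 : (t a + 1) * Real.exp (-(t a + S)) ≤ Real.exp (-S) := by
      have := mul_le_mul_of_nonneg_right (Real.add_one_le_exp (t a)) (Real.exp_pos (-(t a + S))).le
      rw [← Real.exp_add] at this
      have hS : t a + -(t a + S) = -S := by ring
      rwa [hS] at this
    nlinarith

lemma one_sub_ne {a z : ℂ} (ha : ‖a‖ < 1) (hz : ‖z‖ ≤ 1) : 1 - (starRingEnd ℂ) a * z ≠ 0 := by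
  intro h0
  have h1 : (starRingEnd ℂ) a * z = 1 := (sub_eq_zero.1 h0).symm
  have h2 : ‖a‖ * ‖z‖ = 1 := by
    have := congrArg norm h1
    simpa using this
  nlinarith [norm_nonneg a, norm_nonneg z]

lemma normSq_id (a z : ℂ) : ‖1 - (starRingEnd ℂ) a * z‖ ^ 2 - ‖a - z‖ ^ 2 =
    (1 - ‖a‖ ^ 2) * (1 - ‖z‖ ^ 2) := by
  simp only [← Complex.normSq_eq_norm_sq, Complex.normSq_apply]
  simp
  ring

lemma re_kernel {a z : ℂ} (hz : 1 - (starRingEnd ℂ) a * z ≠ 0) :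
    ((1 + (starRingEnd ℂ) a * z) / (1 - (starRingEnd ℂ) a * z)).re =
    (1 - ‖a‖ ^ 2 * ‖z‖ ^ 2) / ‖1 - (starRingEnd ℂ) a * z‖ ^ 2 := by
  have h0 : Complex.normSq (1 - (starRingEnd ℂ) a * z) ≠ 0 := by simpa using hz
  rw [Complex.div_re, ← add_div, ← Complex.normSq_eq_norm_sq (1 - (starRingEnd ℂ) a * z)]
  congr 1
  simp only [← Complex.normSq_eq_norm_sq, Complex.normSq_apply]
  simp
  ring

/-- Jones' function -/
noncomputable def jones (F : Finset ℕ) (l : ℕ → ℂ) (j : ℕ) (z : ℂ) : ℂ :=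
  (∏ k ∈ F.erase j, ((l k - z) / (1 - (starRingEnd ℂ) (l k) * z)) /
      ((l k - l j) / (1 - (starRingEnd ℂ) (l k) * l j))) *
    (((1 - ‖l j‖ ^ 2 : ℝ) : ℂ) / (1 - (starRingEnd ℂ) (l j) * z)) ^ 2 *
    Complex.exp (-∑ k ∈ F with ‖l j‖ ≤ ‖l k‖, ((1 - ‖l k‖ ^ 2 : ℝ) : ℂ) *
      ((1 + (starRingEnd ℂ) (l k) * z) / (1 - (starRingEnd ℂ) (l k) * z) -
       (1 + (starRingEnd ℂ) (l k) * l j) / (1 - (starRingEnd ℂ) (l k) * l j)))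

lemma jones_diff (F : Finset ℕ) (l : ℕ → ℂ) (hd : ∀ k, ‖l k‖ < 1) (j : ℕ) {z : ℂ} (hz : ‖z‖ ≤ 1) :
    DifferentiableAt ℂ (jones F l j) z := by
  have hne : ∀ k, 1 - (starRingEnd ℂ) (l k) * z ≠ 0 := fun k => one_sub_ne (hd k) hz
  unfold jones
  refine DifferentiableAt.mul (DifferentiableAt.mul ?_ ?_) ?_
  · apply DifferentiableAt.fun_finsetProd
    intro k _
    apply DifferentiableAt.div_const
    exact DifferentiableAt.div (by fun_prop) (by fun_prop) (hne k)
  · apply DifferentiableAt.pow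
    exact DifferentiableAt.div (by fun_prop) (by fun_prop) (hne j)
  · apply DifferentiableAt.cexp
    apply DifferentiableAt.neg
    apply DifferentiableAt.fun_sum
    intro k _
    apply DifferentiableAt.const_mul
    apply DifferentiableAt.sub_const
    exact DifferentiableAt.div (by fun_prop) (by fun_prop) (hne k)

lemma jones_self (F : Finset ℕ) (l : ℕ → ℂ) (hd : ∀ k, ‖l k‖ < 1)
    (hinj : ∀ j k, j ≠ k → l j ≠ l k) (j : ℕ) : jones F l j (l j) = 1 := by
  have hne : ∀ k, 1 - (starRingEnd ℂ) (l k) * l j ≠ 0 := fun k => one_sub_ne (hd k) (hd j).le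
  unfold jones
  rw [Finset.prod_eq_one]
  · have h1 : ((1 - ‖l j‖ ^ 2 : ℝ) : ℂ) = 1 - (starRingEnd ℂ) (l j) * l j := by
      rw [Complex.conj_mul']; push_cast; rfl
    rw [h1, div_self (hne j)]
    simp
  · intro k hk
    have : l k - l j ≠ 0 := sub_ne_zero.2 (hinj _ _ (Finset.ne_of_mem_erase hk))
    exact div_self (div_ne_zero this (hne k))

lemma jones_other (F : Finset ℕ) (l : ℕ → ℂ) (i j : ℕ) (hi : i ∈ F) (hij : i ≠ j) :
    jones F l j (l i) = 0 := by
  unfold jones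
  rw [Finset.prod_eq_zero (Finset.mem_erase.2 ⟨hij, hi⟩)]
  · simp
  · simp

lemma jones_bound (F : Finset ℕ) (l : ℕ → ℂ) (hd : ∀ k, ‖l k‖ < 1) {δ : ℝ} (hδ : 0 < δ)
    (hC : ∀ (n : ℕ) (s : Finset ℕ), n ∉ s →
      δ ≤ ∏ k ∈ s, ‖l k - l n‖ / ‖1 - (starRingEnd ℂ) (l k) * l n‖) (j : ℕ)
    {z : ℂ} (hz : ‖z‖ = 1) :
    ‖jones F l j z‖ ≤ (δ⁻¹ * (Real.exp 2 * (δ⁻¹) ^ 4)) *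
      (((1 - ‖l j‖ ^ 2) / ‖1 - (starRingEnd ℂ) (l j) * z‖) ^ 2 *
        Real.exp (-∑ k ∈ F with ‖l j‖ ≤ ‖l k‖,
          ((1 - ‖l k‖ ^ 2) / ‖1 - (starRingEnd ℂ) (l k) * z‖) ^ 2)) := by
  have hne : ∀ k, 1 - (starRingEnd ℂ) (l k) * z ≠ 0 := fun k => one_sub_ne (hd k) hz.le
  have hnej : ∀ k, 1 - (starRingEnd ℂ) (l k) * l j ≠ 0 := fun k => one_sub_ne (hd k) (hd j).le
  have hp : ∀ k, 0 < 1 - ‖l k‖ ^ 2 := fun k => by nlinarith [hd k, norm_nonneg (l k)]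
  have hprod : ‖∏ k ∈ F.erase j, ((l k - z) / (1 - (starRingEnd ℂ) (l k) * z)) /
      ((l k - l j) / (1 - (starRingEnd ℂ) (l k) * l j))‖ ≤ δ⁻¹ := by
    rw [norm_prod]
    have : ∀ k ∈ F.erase j, ‖((l k - z) / (1 - (starRingEnd ℂ) (l k) * z)) /
      ((l k - l j) / (1 - (starRingEnd ℂ) (l k) * l j))‖ =
      (‖l k - l j‖ / ‖1 - (starRingEnd ℂ) (l k) * l j‖)⁻¹ := by
      intro k _
      have h1 := normSq_id (l k) z
      rw [hz] at h1
      have h2 : ‖l k - z‖ = ‖1 - (starRingEnd ℂ) (l k) * z‖ := by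
        rw [← sq_eq_sq₀ (norm_nonneg _) (norm_nonneg _)]; linarith
      rw [norm_div, norm_div, norm_div, h2, div_self (norm_ne_zero_iff.2 (hne k)), one_div]
    rw [Finset.prod_congr rfl this, Finset.prod_inv_distrib]
    exact inv_anti₀ hδ (hC j _ (Finset.notMem_erase _ _))
  -- the exponent sum
  set q : ℕ → ℝ := fun k => (1 - ‖l k‖ ^ 2) * (1 - ‖l j‖ ^ 2) / ‖1 - (starRingEnd ℂ) (l k) * l j‖ ^ 2
    with hq
  have hq0 : ∀ k, 0 ≤ q k := fun k => div_nonneg (mul_nonneg (hp k).le (hp j).le) (by positivity)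
  have hqj : q j = 1 := by
    have h1 : (1 : ℂ) - (starRingEnd ℂ) (l j) * l j = ((1 - ‖l j‖ ^ 2 : ℝ) : ℂ) := by
      rw [Complex.conj_mul']; push_cast; rfl
    simp only [hq]
    rw [h1, Complex.norm_real, Real.norm_of_nonneg (hp j).le]
    have := (hp j).ne'
    field_simp
  have hqs : Real.exp (∑ k ∈ F.erase j, q k) ≤ (δ⁻¹) ^ 2 := by
    have h1 : δ ^ 2 ≤ Real.exp (-∑ k ∈ F.erase j, q k) := by
      calc δ ^ 2 ≤ (∏ k ∈ F.erase j, ‖l k - l j‖ / ‖1 - (starRingEnd ℂ) (l k) * l j‖) ^ 2 :=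
            pow_le_pow_left₀ hδ.le (hC j _ (Finset.notMem_erase _ _)) 2
        _ = ∏ k ∈ F.erase j, (1 - q k) := by
            rw [← Finset.prod_pow]
            apply Finset.prod_congr rfl
            intro k _
            have h0 : ‖1 - (starRingEnd ℂ) (l k) * l j‖ ^ 2 ≠ 0 :=
              pow_ne_zero _ (norm_ne_zero_iff.2 (hnej k))
            simp only [hq]
            rw [div_pow, ← normSq_id]
            rw [sub_div, div_self h0]
            ring
        _ ≤ ∏ k ∈ F.erase j, Real.exp (-q k) := by
            apply Finset.prod_le_prod
            · intro k _
              have h0 : 0 < ‖1 - (starRingEnd ℂ) (l k) * l j‖ ^ 2 :=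
                pow_pos (norm_pos_iff.2 (hnej k)) _
              rw [sub_nonneg]; simp only [hq]
              rw [div_le_one h0, ← normSq_id]
              nlinarith [sq_nonneg ‖l k - l j‖]
            · intro k _
              have := Real.add_one_le_exp (-q k)
              linarith
        _ = _ := by rw [← Real.exp_sum, Finset.sum_neg_distrib]
    rw [Real.exp_neg] at h1
    have h2 := inv_anti₀ (by positivity) h1
    rwa [inv_inv, ← inv_pow] at h2
  have hqF : ∑ k ∈ F, q k ≤ 1 + ∑ k ∈ F.erase j, q k := by
    by_cases hj : j ∈ F
    · rw [← Finset.add_sum_erase _ _ hj, hqj]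
    · rw [Finset.erase_eq_of_notMem hj]; linarith
  have hexp : ‖Complex.exp (-∑ k ∈ F with ‖l j‖ ≤ ‖l k‖, ((1 - ‖l k‖ ^ 2 : ℝ) : ℂ) *
      ((1 + (starRingEnd ℂ) (l k) * z) / (1 - (starRingEnd ℂ) (l k) * z) -
       (1 + (starRingEnd ℂ) (l k) * l j) / (1 - (starRingEnd ℂ) (l k) * l j)))‖ ≤
       (Real.exp 2 * (δ⁻¹) ^ 4) * Real.exp (-∑ k ∈ F with ‖l j‖ ≤ ‖l k‖,
          ((1 - ‖l k‖ ^ 2) / ‖1 - (starRingEnd ℂ) (l k) * z‖) ^ 2) := by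
    rw [Complex.norm_exp]
    have h1 : (-∑ k ∈ F with ‖l j‖ ≤ ‖l k‖, ((1 - ‖l k‖ ^ 2 : ℝ) : ℂ) *
      ((1 + (starRingEnd ℂ) (l k) * z) / (1 - (starRingEnd ℂ) (l k) * z) -
       (1 + (starRingEnd ℂ) (l k) * l j) / (1 - (starRingEnd ℂ) (l k) * l j))).re ≤
       2 + 2 * ∑ k ∈ F.erase j, q k + (-∑ k ∈ F with ‖l j‖ ≤ ‖l k‖,
          ((1 - ‖l k‖ ^ 2) / ‖1 - (starRingEnd ℂ) (l k) * z‖) ^ 2) := by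
      rw [Complex.neg_re, Complex.re_sum]
      have h2 : ∑ k ∈ F with ‖l j‖ ≤ ‖l k‖, (((1 - ‖l k‖ ^ 2) /
          ‖1 - (starRingEnd ℂ) (l k) * z‖) ^ 2 - 2 * q k) ≤
          ∑ k ∈ F with ‖l j‖ ≤ ‖l k‖, (((1 - ‖l k‖ ^ 2 : ℝ) : ℂ) *
      ((1 + (starRingEnd ℂ) (l k) * z) / (1 - (starRingEnd ℂ) (l k) * z) -
       (1 + (starRingEnd ℂ) (l k) * l j) / (1 - (starRingEnd ℂ) (l k) * l j))).re := by
        apply Finset.sum_le_sum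
        intro k hk
        have hk' : ‖l j‖ ≤ ‖l k‖ := (Finset.mem_filter.1 hk).2
        rw [Complex.re_ofReal_mul, Complex.sub_re, re_kernel (hne k), re_kernel (hnej k), hz,
          mul_sub]
        apply sub_le_sub
        · apply le_of_eq
          rw [div_pow]; ring
        · simp only [hq]
          rw [← mul_div_assoc, ← mul_div_assoc]
          apply div_le_div_of_nonneg_right _ (by positivity)
          have h3 : ‖l j‖ ^ 2 ≤ ‖l k‖ ^ 2 := pow_le_pow_left₀ (norm_nonneg _) hk' 2
          have h4 : 1 - ‖l k‖ ^ 2 * ‖l j‖ ^ 2 ≤ 2 * (1 - ‖l j‖ ^ 2) := by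
            nlinarith [hp j, sq_nonneg ‖l j‖, mul_le_mul_of_nonneg_right h3 (sq_nonneg ‖l j‖),
              sq_nonneg (1 - ‖l j‖ ^ 2)]
          nlinarith [hp k]
      rw [Finset.sum_sub_distrib, ← Finset.mul_sum] at h2
      have h5 : ∑ k ∈ F with ‖l j‖ ≤ ‖l k‖, q k ≤ ∑ k ∈ F, q k :=
        Finset.sum_le_sum_of_subset_of_nonneg (Finset.filter_subset _ _) (fun i _ _ => hq0 i)
      linarith
    refine (Real.exp_le_exp.2 h1).trans ?_
    rw [Real.exp_add, Real.exp_add]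
    apply mul_le_mul_of_nonneg_right _ (Real.exp_pos _).le
    apply mul_le_mul_of_nonneg_left _ (Real.exp_pos _).le
    rw [two_mul, Real.exp_add]
    have := mul_le_mul hqs hqs (Real.exp_pos _).le (by positivity)
    refine this.trans (le_of_eq (by ring))
  unfold jones
  rw [norm_mul, norm_mul, norm_pow, norm_div, Complex.norm_real, Real.norm_of_nonneg (hp j).le]
  calc _ ≤ δ⁻¹ * ((1 - ‖l j‖ ^ 2) / ‖1 - (starRingEnd ℂ) (l j) * z‖) ^ 2 *
        ((Real.exp 2 * (δ⁻¹) ^ 4) * Real.exp (-∑ k ∈ F with ‖l j‖ ≤ ‖l k‖,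
          ((1 - ‖l k‖ ^ 2) / ‖1 - (starRingEnd ℂ) (l k) * z‖) ^ 2)) := by
        gcongr
    _ = _ := by ring

lemma interp (l : ℕ → ℂ) (hd : ∀ k, ‖l k‖ < 1) {δ : ℝ} (hδ : 0 < δ)
    (hC : ∀ (n : ℕ) (s : Finset ℕ), n ∉ s →
      δ ≤ ∏ k ∈ s, ‖l k - l n‖ / ‖1 - (starRingEnd ℂ) (l k) * l n‖) (F : Finset ℕ)
    (ε : ℕ → ℂ) (hε : ∀ k, ‖ε k‖ ≤ 1) :
    ∃ f : ℂ → ℂ, (∀ z, ‖z‖ ≤ 1 → DifferentiableAt ℂ f z) ∧ (∀ k ∈ F, f (l k) = ε k) ∧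
      ∀ z, ‖z‖ = 1 → ‖f z‖ ≤ δ⁻¹ * (Real.exp 2 * (δ⁻¹) ^ 4) := by
  have hinj : ∀ j k, j ≠ k → l j ≠ l k := by
    intro j k hjk he
    have := hC j {k} (by simpa using hjk)
    simp [he] at this
    linarith
  refine ⟨fun z => ∑ j ∈ F, ε j * jones F l j z, ?_, ?_, ?_⟩
  · intro z hz
    apply DifferentiableAt.fun_sum
    intro j _
    exact (jones_diff F l hd j hz).const_mul _
  · intro k hk
    show ∑ j ∈ F, ε j * jones F l j (l k) = ε k
    rw [Finset.sum_eq_single_of_mem k hk, jones_self F l hd hinj, mul_one]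
    intro j _ hjk
    rw [jones_other F l k j hk hjk.symm, mul_zero]
  · intro z hz
    have ht := tele F (fun k => ‖l k‖)
      (fun k => ((1 - ‖l k‖ ^ 2) / ‖1 - (starRingEnd ℂ) (l k) * z‖) ^ 2) (fun k => sq_nonneg _)
    calc ‖∑ j ∈ F, ε j * jones F l j z‖ ≤ ∑ j ∈ F, (δ⁻¹ * (Real.exp 2 * (δ⁻¹) ^ 4)) *
      (((1 - ‖l j‖ ^ 2) / ‖1 - (starRingEnd ℂ) (l j) * z‖) ^ 2 *
        Real.exp (-∑ k ∈ F with ‖l j‖ ≤ ‖l k‖,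
          ((1 - ‖l k‖ ^ 2) / ‖1 - (starRingEnd ℂ) (l k) * z‖) ^ 2)) := by
          apply norm_sum_le_of_le
          intro j _
          rw [norm_mul]
          refine le_trans (mul_le_of_le_one_left (norm_nonneg _) (hε j)) ?_
          exact jones_bound F l hd hδ hC j hz
      _ ≤ (δ⁻¹ * (Real.exp 2 * (δ⁻¹) ^ 4)) * 1 := by
          rw [← Finset.mul_sum]
          apply mul_le_mul_of_nonneg_left _ (by positivity)
          refine ht.trans ?_
          linarith [Real.exp_pos (-∑ k ∈ F, ((1 - ‖l k‖ ^ 2) / ‖1 - (starRingEnd ℂ) (l k) * z‖) ^ 2)]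
      _ = _ := mul_one _

/-- Gram form -/
noncomputable def gram (F : Finset ℕ) (l c : ℕ → ℂ) : ℂ :=
  ∑ j ∈ F, ∑ k ∈ F, c j * (starRingEnd ℂ) (c k) * (1 - (starRingEnd ℂ) (l k) * l j)⁻¹

lemma gram_sum (F : Finset ℕ) (l c : ℕ → ℂ) (hd : ∀ k, ‖l k‖ < 1) :
    HasSum (fun n : ℕ => ‖∑ k ∈ F, c k * l k ^ n‖ ^ 2) (gram F l c).re := by
  have h : HasSum (fun n : ℕ => ∑ j ∈ F, ∑ k ∈ F, c j * (starRingEnd ℂ) (c k) *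
      ((starRingEnd ℂ) (l k) * l j) ^ n) (gram F l c) := by
    unfold gram
    apply hasSum_sum
    intro j _
    apply hasSum_sum
    intro k _
    apply HasSum.mul_left
    apply hasSum_geometric_of_norm_lt_one
    rw [norm_mul, RCLike.norm_conj]
    nlinarith [hd j, hd k, norm_nonneg (l j), norm_nonneg (l k)]
  have h2 := Complex.hasSum_re h
  convert h2 using 2 with n
  rw [← Complex.ofReal_re (‖∑ k ∈ F, c k * l k ^ n‖ ^ 2)]
  congr 1
  push_cast
  rw [← Complex.mul_conj', map_sum, Finset.sum_mul_sum]
  apply Finset.sum_congr rfl; intro j _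
  apply Finset.sum_congr rfl; intro k _
  simp only [map_mul, map_pow]
  ring

lemma cauchy (a : ℂ) (ha : ‖a‖ < 1) (g : ℂ → ℂ)
    (hg : DifferentiableOn ℂ g (Metric.closedBall 0 1)) :
    ∫ θ in (0:ℝ)..2 * Real.pi, circleMap 0 1 θ / (circleMap 0 1 θ - a) * g (circleMap 0 1 θ) =
      2 * Real.pi * g a := by
  have h := hg.circleIntegral_sub_inv_smul (w := a) (by simpa using ha)
  rw [circleIntegral] at h
  have h1 : ∀ θ : ℝ, deriv (circleMap 0 1) θ • (circleMap 0 1 θ - a)⁻¹ • g (circleMap 0 1 θ) =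
      Complex.I * (circleMap 0 1 θ / (circleMap 0 1 θ - a) * g (circleMap 0 1 θ)) := by
    intro θ
    rw [deriv_circleMap]
    simp only [smul_eq_mul]
    ring
  simp only [h1] at h
  rw [intervalIntegral.integral_const_mul, smul_eq_mul] at h
  apply mul_left_cancel₀ Complex.I_ne_zero
  rw [h]; ring

/-- the function -/
noncomputable def VV (F : Finset ℕ) (l c : ℕ → ℂ) (w : ℂ) : ℂ := ∑ k ∈ F, c k / (w - l k)

lemma conj_kernel (a : ℂ) (ha : ‖a‖ < 1) {w : ℂ} (hw : ‖w‖ = 1) :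
    (starRingEnd ℂ) (1 / (w - a)) = w * (1 - (starRingEnd ℂ) a * w)⁻¹ := by
  have h1 : (starRingEnd ℂ) w * w = 1 := by rw [Complex.conj_mul', hw]; simp
  have h2 := one_sub_ne ha hw.le
  have h3 : (starRingEnd ℂ) w - (starRingEnd ℂ) a ≠ 0 := by
    intro h0
    apply h2
    rw [← h1, ← sub_mul, h0, zero_mul]
  rw [map_div₀, map_sub, map_one, ← div_eq_mul_inv, div_eq_div_iff h3 h2]
  linear_combination -h1

lemma sub_ne {a w : ℂ} (ha : ‖a‖ < 1) (hw : ‖w‖ = 1) : w - a ≠ 0 := by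
  intro h0
  rw [sub_eq_zero.1 h0] at hw
  linarith

lemma norm_cm (θ : ℝ) : ‖circleMap 0 1 θ‖ = 1 := by simp

lemma VV_cont (F : Finset ℕ) (l c : ℕ → ℂ) (hd : ∀ k, ‖l k‖ < 1) :
    Continuous (fun θ : ℝ => VV F l c (circleMap 0 1 θ)) := by
  unfold VV
  apply continuous_finsetSum
  intro k _
  apply Continuous.div continuous_const
  · exact (continuous_circleMap 0 1).sub continuous_const
  · intro θ; exact sub_ne (hd k) (norm_cm θ)

lemma inv_diff (a : ℂ) (ha : ‖a‖ < 1) :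
    DifferentiableOn ℂ (fun w => (1 - (starRingEnd ℂ) a * w)⁻¹) (Metric.closedBall 0 1) := by
  intro w hw
  apply DifferentiableAt.differentiableWithinAt
  apply DifferentiableAt.inv (by fun_prop)
  exact one_sub_ne ha (by simpa using hw)

lemma gram_int (F : Finset ℕ) (l c : ℕ → ℂ) (hd : ∀ k, ‖l k‖ < 1) :
    ∫ θ in (0:ℝ)..2 * Real.pi, ‖VV F l c (circleMap 0 1 θ)‖ ^ 2 =
      2 * Real.pi * (gram F l c).re := by
  have key : ∫ θ in (0:ℝ)..2 * Real.pi, ((‖VV F l c (circleMap 0 1 θ)‖ ^ 2 : ℝ) : ℂ) =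
      2 * Real.pi * gram F l c := by
    have h1 : ∀ θ : ℝ, ((‖VV F l c (circleMap 0 1 θ)‖ ^ 2 : ℝ) : ℂ) =
        ∑ j ∈ F, ∑ k ∈ F, c j * (starRingEnd ℂ) (c k) *
          (circleMap 0 1 θ / (circleMap 0 1 θ - l j) *
            (1 - (starRingEnd ℂ) (l k) * circleMap 0 1 θ)⁻¹) := by
      intro θ
      push_cast
      unfold VV
      rw [← Complex.mul_conj', map_sum, Finset.sum_mul_sum]
      apply Finset.sum_congr rfl; intro j _
      apply Finset.sum_congr rfl; intro k _
      rw [← mul_one_div (c k), map_mul, conj_kernel (l k) (hd k) (norm_cm θ)]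
      ring
    have hcont : ∀ j k, Continuous (fun θ : ℝ => c j * (starRingEnd ℂ) (c k) *
          (circleMap 0 1 θ / (circleMap 0 1 θ - l j) *
            (1 - (starRingEnd ℂ) (l k) * circleMap 0 1 θ)⁻¹)) := by
      intro j k
      apply Continuous.mul continuous_const
      apply Continuous.mul
      · exact (continuous_circleMap 0 1).div ((continuous_circleMap 0 1).sub continuous_const)
          (fun θ => sub_ne (hd j) (norm_cm θ))
      · exact Continuous.inv₀ (continuous_const.sub (continuous_const.mul (continuous_circleMap 0 1)))
          (fun θ => one_sub_ne (hd k) (norm_cm θ).le)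
    simp only [h1]
    rw [intervalIntegral.integral_finsetSum]
    · unfold gram
      rw [Finset.mul_sum]
      apply Finset.sum_congr rfl; intro j _
      rw [intervalIntegral.integral_finsetSum]
      · rw [Finset.mul_sum]
        apply Finset.sum_congr rfl; intro k _
        rw [intervalIntegral.integral_const_mul, cauchy (l j) (hd j) _ (inv_diff (l k) (hd k))]
        ring
      · intro k _
        exact (hcont j k).intervalIntegrable _ _
    · intro j _
      exact (continuous_finsetSum _ (fun k _ => hcont j k)).intervalIntegrable _ _
  rw [intervalIntegral.integral_ofReal] at key
  have := congrArg Complex.re key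
  rw [Complex.ofReal_re] at this
  rw [this]
  have : (2 * Real.pi * gram F l c : ℂ) = ((2 * Real.pi : ℝ) : ℂ) * gram F l c := by push_cast; rfl
  rw [this, Complex.re_ofReal_mul]

lemma gram_mult (F : Finset ℕ) (l c : ℕ → ℂ) (hd : ∀ k, ‖l k‖ < 1) (ε : ℕ → ℂ) (f : ℂ → ℂ) (C : ℝ)
    (hf : ∀ z, ‖z‖ ≤ 1 → DifferentiableAt ℂ f z) (hfε : ∀ k ∈ F, f (l k) = ε k)
    (hC : ∀ z, ‖z‖ = 1 → ‖f z‖ ≤ C) :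
    (gram F l (fun k => ε k * c k)).re ≤ C ^ 2 * (gram F l c).re := by
  set d : ℕ → ℂ := fun k => ε k * c k with hdd
  set R : ℂ → ℂ := fun w => ∑ k ∈ F, c k * dslope f (l k) w with hR
  have hfd : DifferentiableOn ℂ f (Metric.closedBall 0 1) := fun z hz =>
    (hf z (by simpa using hz)).differentiableWithinAt
  have hRd : DifferentiableOn ℂ R (Metric.closedBall 0 1) := by
    apply DifferentiableOn.fun_sum
    intro k _
    apply DifferentiableOn.const_mul
    refine (Complex.differentiableOn_dslope ?_).2 hfd
    exact Filter.mem_of_superset (Metric.isOpen_ball.mem_nhds (by simpa using hd k))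
      Metric.ball_subset_closedBall
  have hmem : ∀ θ : ℝ, circleMap 0 1 θ ∈ Metric.closedBall (0:ℂ) 1 := fun θ => by simp
  have hRc : Continuous (fun θ : ℝ => R (circleMap 0 1 θ)) :=
    hRd.continuousOn.comp_continuous (continuous_circleMap 0 1) hmem
  have hdec : ∀ w : ℂ, ‖w‖ = 1 → f w * VV F l c w = VV F l d w + R w := by
    intro w hw
    simp only [VV, hR, hdd]
    rw [Finset.mul_sum, ← Finset.sum_add_distrib]
    apply Finset.sum_congr rfl
    intro k hk
    have h0 := sub_ne (hd k) hw
    rw [dslope_of_ne _ (sub_ne_zero.1 h0), slope_def_field, hfε k hk]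
    field_simp
    ring
  have horth : ∫ θ in (0:ℝ)..2 * Real.pi, (starRingEnd ℂ) (VV F l d (circleMap 0 1 θ)) *
      R (circleMap 0 1 θ) = 0 := by
    have h1 := cauchy 0 (by simp)
      (fun w => w * ((∑ k ∈ F, (starRingEnd ℂ) (d k) * (1 - (starRingEnd ℂ) (l k) * w)⁻¹) * R w))
      (by
        apply DifferentiableOn.mul differentiableOn_id
        apply DifferentiableOn.mul _ hRd
        apply DifferentiableOn.fun_sum
        intro k _
        exact (inv_diff (l k) (hd k)).const_mul _)
    simp only [zero_mul, mul_zero, sub_zero] at h1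
    refine Eq.trans ?_ h1
    apply intervalIntegral.integral_congr
    intro θ _
    have hne : circleMap 0 1 θ ≠ 0 := by
      rw [← norm_ne_zero_iff, norm_cm]; exact one_ne_zero
    show _ = _
    simp only
    rw [div_self hne, one_mul, ← mul_assoc]
    congr 1
    unfold VV
    rw [map_sum, Finset.mul_sum]
    apply Finset.sum_congr rfl
    intro k _
    rw [← mul_one_div (d k), map_mul, conj_kernel (l k) (hd k) (norm_cm θ)]
    ring
  have hVd := VV_cont F l d hd
  have hVc := VV_cont F l c hd
  have hcc : Continuous (fun θ : ℝ => (starRingEnd ℂ) (VV F l d (circleMap 0 1 θ)) *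
      R (circleMap 0 1 θ)) := (Complex.continuous_conj.comp hVd).mul hRc
  have hre : ∫ θ in (0:ℝ)..2 * Real.pi, ((starRingEnd ℂ) (VV F l d (circleMap 0 1 θ)) *
      R (circleMap 0 1 θ)).re = 0 := by
    have := Complex.reCLM.intervalIntegral_comp_comm (hcc.intervalIntegrable (μ := MeasureTheory.volume) 0 (2 * Real.pi))
    rw [horth] at this
    simpa using this
  have hpt : ∀ θ : ℝ, ‖VV F l d (circleMap 0 1 θ)‖ ^ 2 ≤ C ^ 2 * ‖VV F l c (circleMap 0 1 θ)‖ ^ 2 -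
      2 * ((starRingEnd ℂ) (VV F l d (circleMap 0 1 θ)) * R (circleMap 0 1 θ)).re := by
    intro θ
    set w := circleMap 0 1 θ
    have hw : ‖w‖ = 1 := norm_cm θ
    have h1 : ‖VV F l d w + R w‖ ^ 2 = ‖VV F l d w‖ ^ 2 + ‖R w‖ ^ 2 +
        2 * ((starRingEnd ℂ) (VV F l d w) * R w).re := by
      simp only [← Complex.normSq_eq_norm_sq, Complex.normSq_apply]
      simp
      ring
    rw [← hdec w hw, norm_mul, mul_pow] at h1
    have h2 : ‖f w‖ ^ 2 ≤ C ^ 2 := pow_le_pow_left₀ (norm_nonneg _) (hC w hw) 2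
    have h3 := mul_le_mul_of_nonneg_right h2 (sq_nonneg ‖VV F l c w‖)
    nlinarith [sq_nonneg ‖R w‖]
  have hc1 : Continuous (fun θ : ℝ => C ^ 2 * ‖VV F l c (circleMap 0 1 θ)‖ ^ 2) :=
    continuous_const.mul (hVc.norm.pow 2)
  have hc2 : Continuous (fun θ : ℝ => 2 * ((starRingEnd ℂ) (VV F l d (circleMap 0 1 θ)) *
      R (circleMap 0 1 θ)).re) := continuous_const.mul (Complex.continuous_re.comp hcc)
  have hint := intervalIntegral.integral_mono_on (a := 0) (b := 2 * Real.pi)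
    (f := fun θ : ℝ => ‖VV F l d (circleMap 0 1 θ)‖ ^ 2)
    (g := fun θ : ℝ => C ^ 2 * ‖VV F l c (circleMap 0 1 θ)‖ ^ 2 -
      2 * ((starRingEnd ℂ) (VV F l d (circleMap 0 1 θ)) * R (circleMap 0 1 θ)).re)
    (μ := MeasureTheory.volume) (by positivity)
    ((hVd.norm.pow 2).intervalIntegrable _ _) ((hc1.sub hc2).intervalIntegrable _ _)
    (fun θ _ => hpt θ)
  rw [intervalIntegral.integral_sub (hc1.intervalIntegrable _ _) (hc2.intervalIntegrable _ _),
    intervalIntegral.integral_const_mul, intervalIntegral.integral_const_mul, hre,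
    gram_int F l d hd, gram_int F l c hd] at hint
  have hpi := Real.pi_pos
  have : 2 * Real.pi * (gram F l d).re ≤ 2 * Real.pi * (C ^ 2 * (gram F l c).re) := by linarith
  exact le_of_mul_le_mul_left this (by positivity)

lemma gram_par (F : Finset ℕ) (l a b : ℕ → ℂ) :
    (gram F l (a + b)).re + (gram F l (a - b)).re = 2 * (gram F l a).re + 2 * (gram F l b).re := by
  have : gram F l (a + b) + gram F l (a - b) = gram F l a + gram F l a + (gram F l b + gram F l b) := by
    unfold gram
    simp only [← Finset.sum_add_distrib]
    apply Finset.sum_congr rfl; intro j _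
    apply Finset.sum_congr rfl; intro k _
    simp only [Pi.add_apply, Pi.sub_apply, map_add, map_sub]
    ring
  have := congrArg Complex.re this
  simp only [Complex.add_re] at this
  linarith

lemma gram_single (F : Finset ℕ) (l : ℕ → ℂ) (k : ℕ) (hk : k ∈ F) (x : ℂ) :
    (gram F l (Pi.single k x)).re = ‖x‖ ^ 2 / (1 - ‖l k‖ ^ 2) := by
  unfold gram
  rw [Finset.sum_eq_single_of_mem k hk, Finset.sum_eq_single_of_mem k hk]
  · rw [Pi.single_eq_same, Complex.mul_conj', Complex.conj_mul', div_eq_mul_inv,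
      ← Complex.ofReal_re (‖x‖ ^ 2 * _)]
    push_cast; rfl
  · intro j _ hj; simp [hj]
  · intro j _ hj; simp [hj]

lemma gram_congr (F : Finset ℕ) (l a b : ℕ → ℂ) (h : ∀ k ∈ F, a k = b k) :
    gram F l a = gram F l b := by
  unfold gram
  apply Finset.sum_congr rfl; intro j hj
  apply Finset.sum_congr rfl; intro k hk
  rw [h j hj, h k hk]

lemma signs {E : Type*} [AddCommGroup E] [Module ℂ E] (N : E → ℝ)
    (hN : ∀ a b, N (a + b) + N (a - b) = 2 * N a + 2 * N b) (v : ℕ → E) (F : Finset ℕ) :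
    ∃ ε : ℕ → ℂ, (∀ k, ε k = 1 ∨ ε k = -1) ∧ N (∑ k ∈ F, ε k • v k) ≤ ∑ k ∈ F, N (v k) := by
  induction F using Finset.induction_on with
  | empty =>
    refine ⟨fun _ => 1, fun _ => Or.inl rfl, ?_⟩
    have := hN 0 0
    simp at this ⊢
    linarith
  | insert a s ha ih =>
    obtain ⟨ε, h1, h2⟩ := ih
    have key : ∃ η : ℂ, (η = 1 ∨ η = -1) ∧
        N (η • v a + ∑ k ∈ s, ε k • v k) ≤ N (v a) + N (∑ k ∈ s, ε k • v k) := by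
      have := hN (∑ k ∈ s, ε k • v k) (v a)
      by_cases hle : N (∑ k ∈ s, ε k • v k + v a) ≤ N (v a) + N (∑ k ∈ s, ε k • v k)
      · exact ⟨1, Or.inl rfl, by rwa [one_smul, add_comm (v a)]⟩
      · refine ⟨-1, Or.inr rfl, ?_⟩
        rw [neg_one_smul, neg_add_eq_sub]
        push Not at hle
        linarith
    obtain ⟨η, h3, h4⟩ := key
    refine ⟨Function.update ε a η, ?_, ?_⟩
    · intro k
      by_cases hk : k = a
      · subst hk; simpa using h3
      · simpa [hk] using h1 k
    · rw [Finset.sum_insert ha, Finset.sum_insert ha]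
      have : ∑ k ∈ s, Function.update ε a η k • v k = ∑ k ∈ s, ε k • v k := by
        apply Finset.sum_congr rfl
        intro k hk
        rw [Function.update_of_ne]
        rintro rfl; exact ha hk
      rw [this, Function.update_self]
      linarith

lemma gram_signs (F : Finset ℕ) (c : ℕ → ℂ) (N : (ℕ → ℂ) → ℝ)
    (hpar : ∀ a b, N (a + b) + N (a - b) = 2 * N a + 2 * N b)
    (hcong : ∀ a b : ℕ → ℂ, (∀ k ∈ F, a k = b k) → N a = N b) :
    ∃ ε : ℕ → ℂ, (∀ k, ε k = 1 ∨ ε k = -1) ∧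
      N (fun k => ε k * c k) ≤ ∑ k ∈ F, N (Pi.single k (c k)) := by
  obtain ⟨ε, h1, h2⟩ := signs N hpar (fun k => Pi.single k (c k)) F
  refine ⟨ε, h1, ?_⟩
  rw [hcong (fun k => ε k * c k) (∑ k ∈ F, ε k • Pi.single k (c k))]
  · exact h2
  · intro k hk
    rw [Finset.sum_apply, Finset.sum_eq_single_of_mem k hk]
    · simp
    · intro j _ hj
      simp [Pi.single_eq_of_ne hj.symm]

lemma gram_bounds (F : Finset ℕ) (l c : ℕ → ℂ) (hd : ∀ k, ‖l k‖ < 1) (C : ℝ)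
    (hI : ∀ ε : ℕ → ℂ, (∀ k, ‖ε k‖ ≤ 1) →
      ∃ f : ℂ → ℂ, (∀ z, ‖z‖ ≤ 1 → DifferentiableAt ℂ f z) ∧ (∀ k ∈ F, f (l k) = ε k) ∧
        ∀ z, ‖z‖ = 1 → ‖f z‖ ≤ C) :
    (gram F l c).re ≤ C ^ 2 * ∑ k ∈ F, ‖c k‖ ^ 2 / (1 - ‖l k‖ ^ 2) ∧
    ∑ k ∈ F, ‖c k‖ ^ 2 / (1 - ‖l k‖ ^ 2) ≤ C ^ 2 * (gram F l c).re := by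
  have hn : ∀ ε : ℕ → ℂ, (∀ k, ε k = 1 ∨ ε k = -1) → ∀ k, ‖ε k‖ ≤ 1 := by
    intro ε h k
    rcases h k with h | h <;> simp [h]
  constructor
  · obtain ⟨ε, h1, h2⟩ := gram_signs F c (fun a => (gram F l a).re) (gram_par F l)
      (fun a b h => by simp only [gram_congr F l a b h])
    obtain ⟨f, hf1, hf2, hf3⟩ := hI ε (hn ε h1)
    have h3 := gram_mult F l (fun k => ε k * c k) hd ε f C hf1 hf2 hf3
    have h4 : (fun k => ε k * (ε k * c k)) = c := by
      funext k
      rcases h1 k with h | h <;> simp [h]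
    rw [h4] at h3
    refine h3.trans (mul_le_mul_of_nonneg_left (h2.trans (le_of_eq ?_)) (sq_nonneg C))
    exact Finset.sum_congr rfl (fun k hk => gram_single F l k hk _)
  · obtain ⟨ε, h1, h2⟩ := gram_signs F c (fun a => -(gram F l a).re)
      (fun a b => by have := gram_par F l a b; linarith)
      (fun a b h => by simp only [gram_congr F l a b h])
    obtain ⟨f, hf1, hf2, hf3⟩ := hI ε (hn ε h1)
    have h3 := gram_mult F l c hd ε f C hf1 hf2 hf3
    have h5 : ∑ k ∈ F, -(gram F l (Pi.single k (c k))).re =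
        -∑ k ∈ F, ‖c k‖ ^ 2 / (1 - ‖l k‖ ^ 2) := by
      rw [← Finset.sum_neg_distrib]
      exact Finset.sum_congr rfl (fun k hk => by rw [gram_single F l k hk])
    rw [h5] at h2
    linarith

/-- Carleson condition implies that the iterated system `{T^n h}` of the diagonal
operator `T e_k = λ_k e_k` applied to `h = ∑ √(1-|λ_k|²) e_k` is a frame. -/
theorem stmt_16 {H : Type*} [NormedAddCommGroup H] [InnerProductSpace ℂ H]
    [CompleteSpace H]
    (b : HilbertBasis ℕ ℂ H) (l : ℕ → ℂ) (hd : ∀ k, ‖l k‖ < 1)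
    (hsum : Summable (fun k => 1 - ‖l k‖ ^ 2))
    (T : H →L[ℂ] H) (hT : ∀ k, T (b k) = l k • b k)
    (h : H) (hh : HasSum (fun k => (Real.sqrt (1 - ‖l k‖ ^ 2) : ℂ) • b k) h)
    (hC : ∃ δ : ℝ, 0 < δ ∧ ∀ (n : ℕ) (s : Finset ℕ), n ∉ s →
      δ ≤ ∏ k ∈ s, ‖l k - l n‖ / ‖1 - (starRingEnd ℂ) (l k) * l n‖) :
    ∃ A B : ℝ, 0 < A ∧ 0 < B ∧ ∀ x : H,
      A * ‖x‖ ^ 2 ≤ ∑' n : ℕ, ‖⟪x, (T ^ n) h⟫‖ ^ 2 ∧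
      ∑' n : ℕ, ‖⟪x, (T ^ n) h⟫‖ ^ 2 ≤ B * ‖x‖ ^ 2 := by
  obtain ⟨δ, hδ, hC⟩ := hC
  set C : ℝ := δ⁻¹ * (Real.exp 2 * (δ⁻¹) ^ 4) with hCdef
  have hCpos : 0 < C := by positivity
  have hp : ∀ k, 0 < 1 - ‖l k‖ ^ 2 := fun k => by nlinarith [hd k, norm_nonneg (l k)]
  set s : ℕ → ℂ := fun k => (Real.sqrt (1 - ‖l k‖ ^ 2) : ℂ) with hs
  have hs2 : ∀ k, ‖s k‖ ^ 2 = 1 - ‖l k‖ ^ 2 := by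
    intro k
    simp only [hs]
    rw [Complex.norm_real, Real.norm_of_nonneg (Real.sqrt_nonneg _), Real.sq_sqrt (hp k).le]
  have hTn : ∀ n k, (T ^ n) (b k) = l k ^ n • b k := by
    intro n k
    induction n with
    | zero => simp
    | succ n ih =>
      rw [pow_succ', mul_apply_eq_comp, ih, map_smul, hT, smul_smul, pow_succ]
  have hcoef : ∀ (x : H) (n : ℕ), HasSum (fun k => ⟪x, b k⟫ * s k * l k ^ n) ⟪x, (T ^ n) h⟫ := by
    intro x n
    have h1 := (hh.mapL (T ^ n)).mapL (innerSL ℂ x)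
    have h2 : (fun k => ⟪x, b k⟫ * s k * l k ^ n) =
        fun k => (innerSL ℂ x) ((T ^ n) (s k • b k)) := ?_
    · rw [h2]; exact h1
    funext k
    rw [map_smul, hTn, map_smul, map_smul, innerSL_apply_apply, smul_eq_mul, smul_eq_mul]
    ring
  have hbd : ∀ (F : Finset ℕ) (a : ℕ → ℂ),
      (gram F l (fun k => a k * s k)).re ≤ C ^ 2 * ∑ k ∈ F, ‖a k‖ ^ 2 ∧
      ∑ k ∈ F, ‖a k‖ ^ 2 ≤ C ^ 2 * (gram F l (fun k => a k * s k)).re := by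
    intro F a
    have h1 := gram_bounds F l (fun k => a k * s k) hd C (fun ε hε => interp l hd hδ hC F ε hε)
    have h2 : ∑ k ∈ F, ‖a k * s k‖ ^ 2 / (1 - ‖l k‖ ^ 2) = ∑ k ∈ F, ‖a k‖ ^ 2 := by
      apply Finset.sum_congr rfl
      intro k _
      rw [norm_mul, mul_pow, hs2, mul_div_assoc, div_self (hp k).ne', mul_one]
    rwa [h2] at h1
  have hbes : ∀ (x : H) (F : Finset ℕ), ∑ k ∈ F, ‖⟪x, b k⟫‖ ^ 2 ≤ ‖x‖ ^ 2 := by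
    intro x F
    have := b.orthonormal.sum_inner_products_le (s := F) x
    simpa only [norm_inner_symm x] using this
  -- upper bound
  have hfin : ∀ (x : H) (M : Finset ℕ), ∑ n ∈ M, ‖⟪x, (T ^ n) h⟫‖ ^ 2 ≤ C ^ 2 * ‖x‖ ^ 2 := by
    intro x M
    have hlim : Tendsto (fun F : Finset ℕ => ∑ n ∈ M, ‖∑ k ∈ F, ⟪x, b k⟫ * s k * l k ^ n‖ ^ 2) atTop
        (𝓝 (∑ n ∈ M, ‖⟪x, (T ^ n) h⟫‖ ^ 2)) := by
      apply tendsto_finsetSum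
      intro n _
      have : Tendsto (fun F : Finset ℕ => ∑ k ∈ F, ⟪x, b k⟫ * s k * l k ^ n) atTop
        (𝓝 ⟪x, (T ^ n) h⟫) := hcoef x n
      exact this.norm.pow 2
    refine le_of_tendsto' hlim (fun F => ?_)
    have h1 := gram_sum F l (fun k => ⟪x, b k⟫ * s k) hd
    refine (sum_le_hasSum M (fun n _ => sq_nonneg _) h1).trans ?_
    exact (hbd F (fun k => ⟪x, b k⟫)).1.trans (mul_le_mul_of_nonneg_left (hbes x F) (sq_nonneg C))
  have hsummable : ∀ x : H, Summable (fun n => ‖⟪x, (T ^ n) h⟫‖ ^ 2) := fun x =>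
    summable_of_sum_le (fun n => sq_nonneg _) (hfin x)
  have hup : ∀ x : H, ∑' n : ℕ, ‖⟪x, (T ^ n) h⟫‖ ^ 2 ≤ C ^ 2 * ‖x‖ ^ 2 := fun x =>
    (hsummable x).tsum_le_of_sum_le (hfin x)
  refine ⟨(2 * C ^ 2)⁻¹, C ^ 2, by positivity, by positivity, fun x => ⟨?_, hup x⟩⟩
  -- lower bound
  set y : Finset ℕ → H := fun F => ∑ k ∈ F, ⟪b k, x⟫ • b k with hy
  have hylim : Tendsto y atTop (𝓝 x) := by
    have h1 : HasSum (fun k => ⟪b k, x⟫ • b k) x := by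
      have := b.hasSum_repr x
      simpa only [b.repr_apply_apply] using this
    exact h1
  have hyn : ∀ F n, ⟪y F, (T ^ n) h⟫ = ∑ k ∈ F, ⟪x, b k⟫ * s k * l k ^ n := by
    intro F n
    simp only [hy]
    rw [sum_inner]
    apply Finset.sum_congr rfl
    intro k _
    rw [inner_smul_left, inner_conj_symm, mul_assoc]
    congr 1
    refine (hcoef (b k) n).unique ?_
    convert hasSum_single k ?_ using 1
    · rw [orthonormal_iff_ite.1 b.orthonormal]; simp
    · intro j hj
      rw [orthonormal_iff_ite.1 b.orthonormal]; simp [hj.symm]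
  have hynorm : ∀ F, ‖y F‖ ^ 2 = ∑ k ∈ F, ‖⟪x, b k⟫‖ ^ 2 := by
    intro F
    have h1 := b.orthonormal.inner_sum (fun k => ⟪b k, x⟫) (fun k => ⟪b k, x⟫) F
    have h2 : ((‖y F‖ ^ 2 : ℝ) : ℂ) = ((∑ k ∈ F, ‖⟪x, b k⟫‖ ^ 2 : ℝ) : ℂ) := by
      push_cast
      refine (inner_self_eq_norm_sq_to_K (𝕜 := ℂ) (y F)).symm.trans (h1.trans ?_)
      apply Finset.sum_congr rfl
      intro k _
      rw [Complex.conj_mul', norm_inner_symm]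
    exact_mod_cast h2
  have hlow : ∀ F, ‖y F‖ ^ 2 ≤ C ^ 2 * (2 * ∑' n : ℕ, ‖⟪x, (T ^ n) h⟫‖ ^ 2 +
      2 * (C ^ 2 * ‖y F - x‖ ^ 2)) := by
    intro F
    rw [hynorm]
    refine (hbd F (fun k => ⟪x, b k⟫)).2.trans (mul_le_mul_of_nonneg_left ?_ (sq_nonneg C))
    have h1 := gram_sum F l (fun k => ⟪x, b k⟫ * s k) hd
    have h2 := ((hsummable x).hasSum.mul_left 2).add ((hsummable (y F - x)).hasSum.mul_left 2)
    have h3 := hasSum_le (fun n => ?_) h1 h2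
    · have := hup (y F - x)
      linarith
    · rw [← hyn F n]
      have h4 : ⟪y F, (T ^ n) h⟫ = ⟪x, (T ^ n) h⟫ + ⟪y F - x, (T ^ n) h⟫ := by
        rw [inner_sub_left]; ring
      rw [h4]
      have h5 := norm_add_le ⟪x, (T ^ n) h⟫ ⟪y F - x, (T ^ n) h⟫
      have h6 := pow_le_pow_left₀ (norm_nonneg _) h5 2
      nlinarith [sq_nonneg (‖⟪x, (T ^ n) h⟫‖ - ‖⟪y F - x, (T ^ n) h⟫‖)]
  have hL1 : Tendsto (fun F => ‖y F‖ ^ 2) atTop (𝓝 (‖x‖ ^ 2)) := hylim.norm.pow 2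
  have hL2 : Tendsto (fun F => C ^ 2 * (2 * ∑' n : ℕ, ‖⟪x, (T ^ n) h⟫‖ ^ 2 +
      2 * (C ^ 2 * ‖y F - x‖ ^ 2))) atTop (𝓝 (C ^ 2 * (2 * ∑' n : ℕ, ‖⟪x, (T ^ n) h⟫‖ ^ 2 +
      2 * (C ^ 2 * ‖x - x‖ ^ 2)))) :=
    (tendsto_const_nhds.add (((((hylim.sub_const x).norm).pow 2).const_mul _).const_mul _)).const_mul _
  have hfinal := le_of_tendsto_of_tendsto' hL1 hL2 hlow
  rw [sub_self, norm_zero] at hfinal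
  rw [inv_mul_le_iff₀ (by positivity)]
  linarith
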